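/- arXiv:2209.07243 — 2 statements merged into one kernel-verified Lean document; each statement's English description precedes it below -/
import Mathlib

section
/- Let N ≥ 2 and X ⊆ {0, 1, …, N−1} be nonempty. Let C_X ⊆ [0,1] be the set of reals having an N-ary expansion all of whose digits lie in X. Then the Hausdorff dimension of C_X equals log(|X|)/log(N). -/
/-- The Cantor-type set of reals with an `N`-ary expansion whose digits all lie in `X`. -/
def cantorDigitSet (N : ℕ) (X : Set ℕ) : Set ℝ :=
  {x | ∃ a : ℕ → ℕ, (∀ i, a i ∈ X) ∧ x = ∑' i, (a i : ℝ) / N ^ (i + 1)}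

namespace CantorAux

open Real Set Filter Topology MeasureTheory

/-- Integer value of the length `n` prefix. -/
def pre {b : ℕ} (c : ℕ → Fin b) : ℕ → ℤ
  | 0 => 0
  | n + 1 => b * pre c n + (c n : ℕ)

lemma sum_eq_pre {b : ℕ} (c : ℕ → Fin b) (n : ℕ) :
    ∑ i ∈ Finset.range n, ofDigitsTerm c i = pre c n * ((b : ℝ) ^ n)⁻¹ := by
  have hb : (b : ℝ) ≠ 0 := by
    have := Fin.pos (c 0)
    positivity
  induction n with
  | zero => simp [pre]
  | succ n ih =>
    rw [Finset.sum_range_succ, ih, ofDigitsTerm, pre]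
    push_cast
    field_simp
    ring

lemma ofDigits_bounds {b : ℕ} (c : ℕ → Fin b) (n : ℕ) :
    pre c n ≤ ofDigits c * (b : ℝ) ^ n ∧ ofDigits c * (b : ℝ) ^ n ≤ pre c n + 1 := by
  have hb : (0 : ℝ) < b := by
    have := Fin.pos (c 0)
    positivity
  have h := ofDigits_eq_sum_add_ofDigits c n
  rw [sum_eq_pre] at h
  have h' : ofDigits c * (b : ℝ) ^ n = pre c n + ofDigits (fun i ↦ c (i + n)) := by
    rw [h]; field_simp
  rw [h']
  have h0 := ofDigits_nonneg (fun i ↦ c (i + n))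
  have h1 := ofDigits_le_one (fun i ↦ c (i + n))
  constructor <;> linarith

lemma strictMono_sub {M N : ℕ} (e : Fin M → Fin N) (he : StrictMono e) (c d : Fin M)
    (h : c ≤ d) : ((d : ℕ) : ℤ) - (c : ℕ) ≤ ((e d : ℕ) : ℤ) - (e c : ℕ) := by
  obtain ⟨c, hc⟩ := c
  obtain ⟨d, hd⟩ := d
  have h : c ≤ d := h
  induction d, h using Nat.le_induction with
  | base => simp
  | succ d hcd ih =>
    have h1 := ih (by omega) (Fin.mk_le_mk.2 hcd)
    have h2 : e ⟨d, by omega⟩ < e ⟨d + 1, hd⟩ := he (by simp)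
    have h3 : (e ⟨d, by omega⟩ : ℕ) < (e ⟨d + 1, hd⟩ : ℕ) := h2
    have h4 : (((⟨d + 1, hd⟩ : Fin M) : ℕ) : ℤ) = d + 1 := by simp
    have h5 : (((⟨d, by omega⟩ : Fin M) : ℕ) : ℤ) = d := by simp
    rw [h5] at h1
    rw [h4]
    omega

lemma strictMono_range {M N : ℕ} (e : Fin M → Fin N) (he : StrictMono e) (c : Fin M) :
    (0 : ℤ) ≤ ((e c : ℕ) : ℤ) - (c : ℕ) ∧ ((e c : ℕ) : ℤ) - (c : ℕ) ≤ N - M := by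
  have hM : 0 < M := Fin.pos c
  have h0 := strictMono_sub e he ⟨0, hM⟩ c (by simp [Fin.le_def])
  have h1 := strictMono_sub e he c ⟨M - 1, by omega⟩ (by have := c.2; simp [Fin.le_def]; omega)
  have h2 := (e ⟨M - 1, by omega⟩).2
  simp only at h0 h1
  constructor <;> omega

lemma pre_lip {M N : ℕ} (e : Fin M → Fin N) (he : StrictMono e) (a b : ℕ → Fin M) (n : ℕ) :
    pre (e ∘ b) n ≤ pre (e ∘ a) n →
      0 ≤ pre a n - pre b n ∧ pre a n - pre b n ≤ pre (e ∘ a) n - pre (e ∘ b) n ∧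
      (pre (e ∘ b) n < pre (e ∘ a) n → pre b n < pre a n) := by
  induction n generalizing a b with
  | zero => simp [pre]
  | succ n ih =>
    intro h
    simp only [pre, Function.comp_apply] at h ⊢
    have hM : 0 < M := Fin.pos (a 0)
    obtain ⟨ha0, ha1⟩ := strictMono_range e he (a n)
    obtain ⟨hb0, hb1⟩ := strictMono_range e he (b n)
    have hea := (e (a n)).2
    have heb := (e (b n)).2
    have hla := (a n).2
    have hlb := (b n).2
    have hMN : M ≤ N := by omega
    have hk : pre (e ∘ b) n ≤ pre (e ∘ a) n := by
      by_contra! hlt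
      have : (N : ℤ) * (pre (e ∘ b) n - pre (e ∘ a) n) ≥ N * 1 := by
        gcongr; omega
      rw [mul_sub] at this
      omega
    obtain ⟨h1, h2, h3⟩ := ih a b hk
    rcases hk.eq_or_lt with hk | hk
    · have hu : pre a n = pre b n := by omega
      rw [hk] at h ⊢
      rw [hu]
      have hba : b n ≤ a n := by
        by_contra! hlt
        have := he hlt
        have : (e (a n) : ℕ) < e (b n) := this
        omega
      have := strictMono_sub e he _ _ hba
      have h6 : (b n : ℕ) ≤ a n := hba
      refine ⟨by omega, by omega, fun h7 => ?_⟩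
      rcases hba.eq_or_lt with h8 | h8
      · rw [h8] at h7; omega
      · have h8 : (b n : ℕ) < a n := h8
        omega
    · generalize pre (e ∘ a) n = A at *
      generalize pre (e ∘ b) n = B at *
      generalize pre a n = A' at *
      generalize pre b n = B' at *
      have hN : (M : ℤ) ≤ N := by exact_mod_cast hMN
      have key : ((N : ℤ) - M) * 1 ≤ (N - M) * (A - B) := by
        apply mul_le_mul_of_nonneg_left <;> omega
      have key2 : 0 ≤ (M : ℤ) * ((A - B) - (A' - B')) := by
        apply mul_nonneg <;> omega
      have key3 : (M : ℤ) * 1 ≤ M * (A' - B') := by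
        have := h3 hk
        apply mul_le_mul_of_nonneg_left <;> omega
      refine ⟨by nlinarith, by nlinarith, fun _ => by nlinarith⟩

lemma ofDigits_holder_aux {M N : ℕ} (e : Fin M → Fin N) (he : StrictMono e) (a b : ℕ → Fin M)
    (n : ℕ) (h : |ofDigits (e ∘ a) - ofDigits (e ∘ b)| ≤ ((N : ℝ) ^ n)⁻¹) :
    |ofDigits a - ofDigits b| ≤ 3 * ((M : ℝ) ^ n)⁻¹ := by
  wlog hab : pre (e ∘ b) n ≤ pre (e ∘ a) n generalizing a b
  · rw [abs_sub_comm]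
    exact this b a (by rwa [abs_sub_comm]) (by omega)
  have hM : (0 : ℝ) < (M : ℝ) ^ n := by
    have := Fin.pos (a 0)
    positivity
  have hN : (0 : ℝ) < (N : ℝ) ^ n := by
    have := Fin.pos (e (a 0))
    positivity
  obtain ⟨h1, h2, -⟩ := pre_lip e he a b n hab
  obtain ⟨p1, p2⟩ := ofDigits_bounds a n
  obtain ⟨p3, p4⟩ := ofDigits_bounds b n
  obtain ⟨p5, p6⟩ := ofDigits_bounds (e ∘ a) n
  obtain ⟨p7, p8⟩ := ofDigits_bounds (e ∘ b) n
  have h3 : (ofDigits (e ∘ a) - ofDigits (e ∘ b)) * (N : ℝ) ^ n ≤ 1 := by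
    have := (le_abs_self _).trans h
    rwa [← one_div, le_div_iff₀ hN] at this
  have h4 : ((pre (e ∘ a) n - pre (e ∘ b) n : ℤ) : ℝ) ≤ 2 := by
    push_cast; linarith
  have h5 : ((pre a n - pre b n : ℤ) : ℝ) ≤ 2 := le_trans (by exact_mod_cast h2) h4
  have h6 : (0 : ℝ) ≤ ((pre a n - pre b n : ℤ) : ℝ) := by exact_mod_cast h1
  push_cast at h5 h6
  rw [← div_eq_mul_inv, le_div_iff₀ hM, ← abs_of_pos hM, ← abs_mul, abs_le]
  constructor <;> linarith

lemma pow_exp {M N : ℕ} (hM : 0 < M) (hN : 2 ≤ N) (n : ℕ) :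
    (((N : ℝ) ^ n)⁻¹) ^ (Real.log M / Real.log N) = ((M : ℝ) ^ n)⁻¹ := by
  have hN0 : (0 : ℝ) < N := by positivity
  have hl : Real.log N ≠ 0 := (Real.log_pos (by exact_mod_cast hN)).ne'
  have : (N : ℝ) ^ (Real.log M / Real.log N) = M := by
    rw [Real.rpow_def_of_pos hN0, mul_div_cancel₀ _ hl, Real.exp_log (by positivity)]
  rw [Real.inv_rpow (by positivity), ← Real.rpow_natCast, ← Real.rpow_mul hN0.le, mul_comm,
    Real.rpow_mul hN0.le, this, Real.rpow_natCast]

lemma ofDigits_holder {M N : ℕ} (hM : 2 ≤ M) (hN : 2 ≤ N) (e : Fin M → Fin N)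
    (he : StrictMono e) (a b : ℕ → Fin M) :
    |ofDigits a - ofDigits b| ≤
      3 * M * |ofDigits (e ∘ a) - ofDigits (e ∘ b)| ^ (Real.log M / Real.log N) := by
  have hM1 : (1 : ℝ) < M := by exact_mod_cast hM
  have hN1 : (1 : ℝ) < N := by exact_mod_cast hN
  have hs : 0 < Real.log M / Real.log N := div_pos (Real.log_pos hM1) (Real.log_pos hN1)
  rcases (abs_nonneg (ofDigits (e ∘ a) - ofDigits (e ∘ b))).eq_or_lt with h0 | h0
  · rw [← h0, Real.zero_rpow hs.ne', mul_zero]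
    have ht : Tendsto (fun n : ℕ => 3 * ((M : ℝ) ^ n)⁻¹) atTop (𝓝 (3 * 0)) :=
      (tendsto_inv_atTop_zero.comp (tendsto_pow_atTop_atTop_of_one_lt hM1)).const_mul 3
    rw [mul_zero] at ht
    refine ge_of_tendsto' ht fun n => ofDigits_holder_aux e he a b n ?_
    rw [← h0]; positivity
  · have h1 : |ofDigits (e ∘ a) - ofDigits (e ∘ b)| ≤ 1 := by
      rw [abs_le]
      have := ofDigits_nonneg (e ∘ a)
      have := ofDigits_nonneg (e ∘ b)
      have := ofDigits_le_one (e ∘ a)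
      have := ofDigits_le_one (e ∘ b)
      constructor <;> linarith
    obtain ⟨n, hn1, hn2⟩ := exists_nat_pow_near_of_lt_one h0 h1
      (y := (N : ℝ)⁻¹) (by positivity) (inv_lt_one_of_one_lt₀ hN1)
    rw [inv_pow] at hn1 hn2
    have hA := ofDigits_holder_aux e he a b n hn2
    have hB := Real.rpow_le_rpow (by positivity) hn1.le hs.le
    rw [pow_exp (by omega) hN] at hB
    calc _ ≤ _ := hA
      _ = 3 * M * ((M : ℝ) ^ (n + 1))⁻¹ := by field_simp; ring
      _ ≤ _ := by gcongr

lemma lower {M N : ℕ} (hM : 2 ≤ M) (hN : 2 ≤ N) (e : Fin M → Fin N)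
    (he : StrictMono e) :
    ENNReal.ofReal (Real.log M / Real.log N) ≤
      dimH (range fun c : ℕ → Fin M => ofDigits (e ∘ c)) := by
  have hM1 : (1 : ℝ) < M := by exact_mod_cast hM
  have hN1 : (1 : ℝ) < N := by exact_mod_cast hN
  have hs : 0 < Real.log M / Real.log N := div_pos (Real.log_pos hM1) (Real.log_pos hN1)
  have key := ofDigits_holder hM hN e he
  have : Nonempty (ℕ → Fin M) := ⟨fun _ => ⟨0, by omega⟩⟩
  set φ : (ℕ → Fin M) → ℝ := fun c => ofDigits (e ∘ c) with hφ
  set F : ℝ → ℝ := fun x => ofDigits (Function.invFun φ x) with hF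
  have hFφ : ∀ c, F (φ c) = ofDigits c := by
    intro c
    have h1 : φ (Function.invFun φ (φ c)) = φ c := Function.invFun_eq ⟨c, rfl⟩
    have h2 := key (Function.invFun φ (φ c)) c
    have h3 : ofDigits (e ∘ Function.invFun φ (φ c)) = ofDigits (e ∘ c) := h1
    rw [h3, sub_self, abs_zero, Real.zero_rpow hs.ne', mul_zero] at h2
    exact sub_eq_zero.mp (abs_nonpos_iff.mp h2)
  have himg : Icc (0 : ℝ) 1 ⊆ F '' range φ := by
    intro y hy
    obtain ⟨c, -, hc⟩ := ofDigits_SurjOn (b := M) hM hy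
    exact ⟨φ c, ⟨c, rfl⟩, by rw [hFφ, hc]⟩
  have hco : ((Real.log M / Real.log N).toNNReal : ℝ) = Real.log M / Real.log N :=
    Real.coe_toNNReal _ hs.le
  have hH : HolderOnWith (3 * M) (Real.log M / Real.log N).toNNReal F (range φ) := by
    rintro _ ⟨a, rfl⟩ _ ⟨b, rfl⟩
    rw [hFφ, hFφ, edist_dist, edist_dist, Real.dist_eq, Real.dist_eq]
    have h3 : (((3 * M : NNReal)) : ENNReal) = ENNReal.ofReal (3 * M) := by
      rw [ENNReal.ofReal, Real.toNNReal_mul (by norm_num)]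
      simp
    rw [h3, hco, ENNReal.ofReal_rpow_of_nonneg (abs_nonneg _) hs.le,
      ← ENNReal.ofReal_mul (by positivity)]
    exact ENNReal.ofReal_le_ofReal (key a b)
  have h1 := hH.dimH_image_le (Real.toNNReal_pos.2 hs)
  have h2 : (1 : ENNReal) ≤ dimH (F '' range φ) := by
    refine le_trans ?_ (dimH_mono himg)
    rw [Real.dimH_of_nonempty_interior (by simp)]
    simp
  have h3 := h2.trans h1
  have hne : ENNReal.ofReal (Real.log M / Real.log N) ≠ 0 := by simpa using hs
  change 1 ≤ dimH (range φ) / ENNReal.ofReal (Real.log M / Real.log N) at h3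
  rw [ENNReal.le_div_iff_mul_le (Or.inl hne) (Or.inl ENNReal.ofReal_ne_top), one_mul] at h3
  exact h3

lemma upper {M N : ℕ} (hM : 0 < M) (hN : 2 ≤ N) (e : Fin M → Fin N) :
    dimH (range fun c : ℕ → Fin M => ofDigits (e ∘ c)) ≤
      ENNReal.ofReal (Real.log M / Real.log N) := by
  have hN1 : (1 : ℝ) < N := by exact_mod_cast hN
  have hs : 0 ≤ Real.log M / Real.log N :=
    div_nonneg (Real.log_natCast_nonneg _) (Real.log_natCast_nonneg _)
  rw [ENNReal.ofReal_eq_coe_nnreal hs]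
  apply dimH_le_of_hausdorffMeasure_ne_top
  rw [NNReal.coe_mk]
  set φ : (ℕ → Fin M) → ℝ := fun c => ofDigits (e ∘ c) with hφ
  have hdiam : ∀ (n : ℕ) (w : Fin n → Fin M),
      Metric.ediam (φ '' {c | ∀ i : Fin n, c i = w i}) ≤ ENNReal.ofReal (((N : ℝ) ^ n)⁻¹) := by
    intro n w
    apply Metric.ediam_le
    rintro _ ⟨a, ha, rfl⟩ _ ⟨b, hb, rfl⟩
    rw [edist_dist, Real.dist_eq]
    apply ENNReal.ofReal_le_ofReal
    apply abs_ofDigits_sub_ofDigits_le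
    intro i hi
    have h1 := ha ⟨i, hi⟩
    have h2 := hb ⟨i, hi⟩
    simp only at h1 h2
    simp [h1, h2]
  have hle := Measure.hausdorffMeasure_le_liminf_sum (Real.log M / Real.log N) (range φ)
    (l := atTop) (ι := fun n : ℕ => Fin n → Fin M)
    (fun n : ℕ => ENNReal.ofReal (((N : ℝ) ^ n)⁻¹))
    (by
      have : Tendsto (fun n : ℕ => ((N : ℝ) ^ n)⁻¹) atTop (𝓝 0) :=
        tendsto_inv_atTop_zero.comp (tendsto_pow_atTop_atTop_of_one_lt hN1)
      simpa using ENNReal.tendsto_ofReal this)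
    (fun n w => φ '' {c | ∀ i : Fin n, c i = w i})
    (Eventually.of_forall hdiam)
    (Eventually.of_forall fun n => by
      rintro _ ⟨c, rfl⟩
      exact mem_iUnion.2 ⟨fun i => c i, c, fun i => rfl, rfl⟩)
  have hsum : ∀ n : ℕ, ∑ w : Fin n → Fin M,
      Metric.ediam (φ '' {c | ∀ i : Fin n, c i = w i}) ^ (Real.log M / Real.log N) ≤ 1 := by
    intro n
    calc _ ≤ ∑ w : Fin n → Fin M, ENNReal.ofReal (((M : ℝ) ^ n)⁻¹) := by
          apply Finset.sum_le_sum
          intro w _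
          refine (ENNReal.rpow_le_rpow (hdiam n w) hs).trans ?_
          rw [ENNReal.ofReal_rpow_of_nonneg (by positivity) hs, pow_exp hM hN]
      _ = 1 := by
          rw [Finset.sum_const, nsmul_eq_mul, ← ENNReal.ofReal_natCast,
            ← ENNReal.ofReal_mul (by positivity)]
          have hc : ((Fintype.card (Fin n → Fin M) : ℕ) : ℝ) = (M : ℝ) ^ n := by simp
          rw [Finset.card_univ, hc, mul_inv_cancel₀ (by positivity), ENNReal.ofReal_one]
  have h1 : μH[Real.log M / Real.log N] (range φ) ≤ 1 := by
    refine hle.trans ?_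
    refine (liminf_le_liminf (Eventually.of_forall hsum)).trans ?_
    simp
  exact (h1.trans_lt ENNReal.one_lt_top).ne

end CantorAux

/-- The Hausdorff dimension of `C_X` equals `log|X| / log N`. -/
theorem dimH_cantorDigitSet (N : ℕ) (hN : 2 ≤ N) (X : Finset ℕ) (hX : X.Nonempty)
    (hXN : ∀ d ∈ X, d < N) :
    dimH (cantorDigitSet N ↑X) = ENNReal.ofReal (Real.log X.card / Real.log N) := by
  have hmem : ∀ i, X.orderEmbOfFin rfl i ∈ X := fun i => X.orderEmbOfFin_mem rfl i
  let e : Fin X.card → Fin N := fun i => ⟨X.orderEmbOfFin rfl i, hXN _ (hmem i)⟩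
  have he : StrictMono e := fun i j h => (X.orderEmbOfFin rfl).strictMono h
  have hC : cantorDigitSet N ↑X = Set.range fun c : ℕ → Fin X.card => Real.ofDigits (e ∘ c) := by
    ext x
    constructor
    · rintro ⟨a, ha, rfl⟩
      have : ∀ i, ∃ j, X.orderEmbOfFin rfl j = a i := by
        intro i
        have : a i ∈ Set.range (X.orderEmbOfFin rfl) := by
          rw [Finset.range_orderEmbOfFin]; exact ha i
        exact this
      choose c hc using this
      refine ⟨c, ?_⟩
      simp only [Real.ofDigits, Real.ofDigitsTerm, Function.comp_apply, e, hc, div_eq_mul_inv]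
    · rintro ⟨c, rfl⟩
      refine ⟨fun i => X.orderEmbOfFin rfl (c i), fun i => hmem _, ?_⟩
      simp only [Real.ofDigits, Real.ofDigitsTerm, Function.comp_apply, e, div_eq_mul_inv]
  rw [hC]
  have hpos : 0 < X.card := hX.card_pos
  refine le_antisymm (CantorAux.upper hpos hN e) ?_
  rcases Nat.lt_or_ge X.card 2 with h | h
  · have : X.card = 1 := by omega
    have h0 : Real.log (X.card : ℝ) / Real.log N = 0 := by simp [this]
    rw [h0]; simp
  · exact CantorAux.lower h hN e he
end

section
/- Let N ≥ 2, m ≥ 1, and A ⊆ {0,…,N−1}^m nonempty. Let C_A ⊆ [0,1]^m be the set of points (x¹,…,x^m) admitting N-ary expansions x^j = Σ_i x^j_i N^{-i} such that (x¹_i, …, x^m_i) ∈ A for every i. Then both the Hausdorff and packing dimensions of C_A equal log(|A|)/log(N). -/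
open scoped ENNReal

/-- Extended-real logarithm of an `ℝ≥0∞` value. -/
noncomputable def elog (x : ℝ≥0∞) : EReal :=
  if x = ⊤ then (⊤ : EReal) else ((Real.log x.toReal : ℝ) : EReal)

/-- Minimal number of `ε`-balls needed to cover `s` (`⊤` if no finite cover exists). -/
noncomputable def coveringNumber {α : Type*} [PseudoMetricSpace α] (ε : ℝ) (s : Set α) : ℝ≥0∞ :=
  ⨅ (t : Finset α) (_ : s ⊆ ⋃ x ∈ t, Metric.ball x ε), (t.card : ℝ≥0∞)

/-- Upper box (Minkowski) dimension: `limsup log N(1/n, s) / log n`. -/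
noncomputable def upperBoxDim {α : Type*} [PseudoMetricSpace α] (s : Set α) : EReal :=
  Filter.limsup
    (fun n : ℕ => elog (coveringNumber (1 / n) s) * (((Real.log n)⁻¹ : ℝ) : EReal))
    Filter.atTop

/-- Packing dimension: infimum over countable covers of the supremum of the
upper box dimensions of the pieces. -/
noncomputable def packingDim {α : Type*} [PseudoMetricSpace α] (s : Set α) : EReal :=
  ⨅ (c : ℕ → Set α) (_ : s ⊆ ⋃ n, c n), ⨆ n, upperBoxDim (c n)

/-- The multidimensional Cantor-type set built from the digit set `A`. -/
def cantorDigitSetPi (N : ℕ) {ι : Type*} (A : Set (ι → ℕ)) : Set (ι → ℝ) :=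
  {x | ∃ a : ℕ → ι → ℕ, (∀ i, a i ∈ A) ∧ ∀ j, x j = ∑' i, (a i j : ℝ) / N ^ (i + 1)}

open MeasureTheory Filter Topology Set

/-! integer prefix -/
def cdPre (N : ℕ) (a : ℕ → ℕ) : ℕ → ℕ
  | 0 => 0
  | k + 1 => N * cdPre N a k + a k

lemma cdPre_inj {N : ℕ} {a a' : ℕ → ℕ} (h : ∀ i, a i < N) (h' : ∀ i, a' i < N) (k : ℕ)
    (hk : cdPre N a k = cdPre N a' k) : ∀ i < k, a i = a' i := by
  induction k with
  | zero => intro i hi; omega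
  | succ k ih =>
    have hN : 0 < N := lt_of_le_of_lt (Nat.zero_le _) (h 0)
    simp only [cdPre] at hk
    have h1 : a k = a' k := by
      have := congrArg (· % N) hk
      simpa [Nat.mul_add_mod, Nat.mod_eq_of_lt (h k), Nat.mod_eq_of_lt (h' k)] using this
    have h2 : cdPre N a k = cdPre N a' k := by
      rw [h1] at hk
      exact Nat.eq_of_mul_eq_mul_left hN (by omega)
    intro i hi
    rcases Nat.lt_succ_iff_lt_or_eq.1 hi with hi | rfl
    · exact ih h2 i hi
    · exact h1

lemma cdPre_congr {N : ℕ} {a a' : ℕ → ℕ} (k : ℕ) (h : ∀ i < k, a i = a' i) :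
    cdPre N a k = cdPre N a' k := by
  induction k with
  | zero => rfl
  | succ k ih => 
    simp only [cdPre]
    rw [ih (fun i hi => h i (by omega)), h k (by omega)]

lemma cdPre_sum {N : ℕ} (a : ℕ → Fin N) (k : ℕ) :
    (N : ℝ) ^ k * ∑ i ∈ Finset.range k, Real.ofDigitsTerm a i = cdPre N (fun i => a i) k := by
  have hN : (N : ℝ) ≠ 0 := by
    have := Fin.pos (a 0)
    positivity
  induction k with
  | zero => simp [cdPre]
  | succ k ih =>
    rw [Finset.sum_range_succ, mul_add, pow_succ', mul_assoc, ih, Real.ofDigitsTerm]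
    simp only [cdPre]
    push_cast
    field_simp
    ring

noncomputable def cdVal (N : ℕ) (a : ℕ → ℕ) : ℝ := ∑' i, (a i : ℝ) / N ^ (i + 1)

lemma cdVal_bounds {N : ℕ} {a : ℕ → ℕ} (h : ∀ i, a i < N) (k : ℕ) :
    (cdPre N a k : ℝ) ≤ N ^ k * cdVal N a ∧ N ^ k * cdVal N a ≤ cdPre N a k + 1 := by
  set f : ℕ → Fin N := fun i => ⟨a i, h i⟩ with hf
  have hv : cdVal N a = Real.ofDigits f := by
    simp [cdVal, Real.ofDigits, Real.ofDigitsTerm, hf, div_eq_mul_inv]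
  have hN : (N : ℝ) ≠ 0 := by
    have := Fin.pos (f 0)
    positivity
  have hp : cdPre N a k = (N : ℝ) ^ k * ∑ i ∈ Finset.range k, Real.ofDigitsTerm f i := by
    rw [cdPre_sum]
  rw [hv, hp, Real.ofDigits_eq_sum_add_ofDigits f k, mul_add, mul_inv_cancel_left₀ (by positivity)]
  have h0 := Real.ofDigits_nonneg (fun i => f (i + k))
  have h1 := Real.ofDigits_le_one (fun i => f (i + k))
  constructor <;> linarith

/-! box dim of nonneg -/
lemma elog_cov_nonneg {α : Type*} [PseudoMetricSpace α] (ε : ℝ) (s : Set α) :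
    0 ≤ elog (coveringNumber ε s) := by
  unfold elog
  split_ifs with h
  · exact le_top
  · have h1 : coveringNumber ε s = 0 ∨ 1 ≤ coveringNumber ε s := by
      by_contra! hc
      obtain ⟨h0, h1⟩ := hc
      unfold coveringNumber at h1
      simp only [iInf_lt_iff] at h1
      obtain ⟨t, ht, hlt⟩ := h1
      have : t.card = 0 := by
        have : t.card < 1 := by exact_mod_cast hlt
        omega
      apply h0
      apply le_antisymm _ bot_le
      unfold coveringNumber
      refine (iInf₂_le t ht).trans ?_
      simp [this]
    have : 0 ≤ Real.log (coveringNumber ε s).toReal := by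
      rcases h1 with h1 | h1
      · simp [h1]
      · apply Real.log_nonneg
        have := ENNReal.toReal_mono h h1
        simpa using this
    exact_mod_cast this

lemma ubd_nonneg {α : Type*} [PseudoMetricSpace α] (s : Set α) : 0 ≤ upperBoxDim s := by
  unfold upperBoxDim
  refine le_limsup_of_frequently_le ?_ (by isBoundedDefault)
  refine Frequently.of_forall fun n => ?_
  refine mul_nonneg (elog_cov_nonneg _ _) ?_
  have : (0:ℝ) ≤ (Real.log n)⁻¹ := inv_nonneg.2 (Real.log_natCast_nonneg n)
  exact_mod_cast this

lemma exists_cover {α : Type*} [PseudoMetricSpace α] (s : Set α) (d : ℝ) (n : ℕ) (hn : 2 ≤ n)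
    (h : elog (coveringNumber (1 / n) s) * (((Real.log n)⁻¹ : ℝ) : EReal) < d) :
    ∃ t : Finset α, (s ⊆ ⋃ x ∈ t, Metric.ball x (1 / n)) ∧ (t.card : ℝ) ≤ (n : ℝ) ^ d := by
  have hl : 0 < Real.log n := Real.log_pos (by exact_mod_cast hn)
  have hfin : coveringNumber (1 / n) s ≠ ⊤ := by
    intro htop
    rw [htop] at h
    simp only [elog, if_true] at h
    rw [EReal.top_mul_coe_of_pos (inv_pos.2 hl)] at h
    exact not_top_lt h
  have hlt : coveringNumber (1 / n) s < ENNReal.ofReal ((n : ℝ) ^ d) := by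
    rw [elog, if_neg hfin] at h
    have h' : Real.log (coveringNumber (1 / n) s).toReal * (Real.log n)⁻¹ < d := by exact_mod_cast h
    rw [← div_eq_mul_inv, div_lt_iff₀ hl] at h'
    rw [ENNReal.lt_ofReal_iff_toReal_lt hfin]
    have hnpos : (0 : ℝ) < n := by positivity
    have hpos : 0 < (n : ℝ) ^ d := Real.rpow_pos_of_pos hnpos d
    rcases (ENNReal.toReal_nonneg (a := coveringNumber (1 / n) s)).eq_or_lt with h0 | h0
    · rw [← h0]; exact hpos
    · rw [← Real.log_lt_log_iff h0 hpos, Real.log_rpow hnpos]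
      exact h'
  unfold coveringNumber at hlt
  simp only [iInf_lt_iff] at hlt
  obtain ⟨t, ht, hlt⟩ := hlt
  refine ⟨t, ht, ?_⟩
  have := (ENNReal.lt_ofReal_iff_toReal_lt (by simp)).1 hlt
  simpa using this.le

lemma dimH_le_ubd {X : Type*} [MetricSpace X] (s : Set X) :
    ((dimH s : ℝ≥0∞) : EReal) ≤ upperBoxDim s := by
  by_contra! hlt
  obtain ⟨q, hq1, hq2⟩ := EReal.exists_between_coe_real hlt
  have hq0 : 0 ≤ q := by
    have := (ubd_nonneg s).trans hq1.le
    exact_mod_cast this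
  lift q to NNReal using hq0
  borelize X
  have hev : ∀ᶠ n : ℕ in atTop, 2 ≤ n ∧
      elog (coveringNumber (1 / n) s) * (((Real.log n)⁻¹ : ℝ) : EReal) < ((q : ℝ) : EReal) :=
    (eventually_ge_atTop 2).and (eventually_lt_of_limsup_lt hq1 (by isBoundedDefault))
  have hex : ∀ n : ℕ, ∃ t : Finset X, (2 ≤ n ∧
      elog (coveringNumber (1 / n) s) * (((Real.log n)⁻¹ : ℝ) : EReal) < ((q : ℝ) : EReal)) →
      (s ⊆ ⋃ x ∈ t, Metric.ball x (1 / n)) ∧ (t.card : ℝ) ≤ (n : ℝ) ^ (q : ℝ) := by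
    intro n
    by_cases h : (2 ≤ n ∧
      elog (coveringNumber (1 / n) s) * (((Real.log n)⁻¹ : ℝ) : EReal) < ((q : ℝ) : EReal))
    · obtain ⟨t, ht⟩ := exists_cover s q n h.1 h.2
      exact ⟨t, fun _ => ht⟩
    · exact ⟨∅, fun h' => absurd h' h⟩
  choose t ht using hex
  have hdiam : ∀ (n : ℕ) (x : X), Metric.ediam (Metric.ball x (1 / (n:ℝ))) ≤ ENNReal.ofReal (2 / n) := by
    intro n x
    rw [← Metric.eball_ofReal]
    refine Metric.ediam_eball_le.trans ?_
    rw [show (2 : ℝ) / n = 2 * (1 / n) by ring, ENNReal.ofReal_mul (by norm_num)]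
    simp
  have key : μH[(q : ℝ)] s ≤ ENNReal.ofReal (2 ^ (q : ℝ)) := by
    refine (Measure.hausdorffMeasure_le_liminf_sum (ι := fun n => t n) (q : ℝ) s (l := atTop)
      (fun n : ℕ => ENNReal.ofReal (2 / n)) ?_ (fun n x => Metric.ball (x : X) (1 / n)) ?_ ?_).trans ?_
    · rw [← ENNReal.ofReal_zero]
      exact ENNReal.tendsto_ofReal (tendsto_const_div_atTop_nhds_zero_nat 2)
    · exact Eventually.of_forall fun n i => hdiam n _
    · filter_upwards [hev] with n hn
      refine (ht n hn).1.trans ?_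
      intro y hy
      simp only [mem_iUnion] at hy ⊢
      obtain ⟨x, hx, hy⟩ := hy
      exact ⟨⟨x, hx⟩, hy⟩
    · refine liminf_le_of_frequently_le' (Eventually.frequently ?_)
      filter_upwards [hev] with n hn
      have hn0 : (0 : ℝ) < n := by have := hn.1; positivity
      calc ∑ i : t n, Metric.ediam (Metric.ball (i : X) (1 / (n:ℝ))) ^ (q : ℝ)
          ≤ ∑ i : t n, ENNReal.ofReal (2 / n) ^ (q : ℝ) := by
            gcongr
            exact hdiam n _
        _ = ENNReal.ofReal ((t n).card * (2 / n) ^ (q : ℝ)) := by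
            rw [ENNReal.ofReal_mul (by positivity), 
              ENNReal.ofReal_rpow_of_nonneg (by positivity) (by positivity)]
            simp
        _ ≤ ENNReal.ofReal (2 ^ (q : ℝ)) := by
            apply ENNReal.ofReal_le_ofReal
            rw [Real.div_rpow (by positivity) (by positivity)]
            have := (ht n hn).2
            have hp : 0 < (n : ℝ) ^ (q : ℝ) := Real.rpow_pos_of_pos hn0 _
            have hp2 : (0:ℝ) < 2 ^ (q : ℝ) := by positivity
            rw [← mul_div_assoc, div_le_iff₀ hp]
            nlinarith
  have := dimH_le_of_hausdorffMeasure_ne_top (ne_top_of_le_ne_top ENNReal.ofReal_ne_top key)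
  apply absurd hq2
  rw [not_lt]
  have h2 := EReal.coe_ennreal_le_coe_ennreal_iff.2 this
  exact h2

lemma dimH_le_packingDim {X : Type*} [MetricSpace X] (s : Set X) :
    ((dimH s : ℝ≥0∞) : EReal) ≤ packingDim s := by
  unfold packingDim
  refine le_iInf₂ fun c hc => ?_
  by_contra! hlt
  have h1 : dimH s ≤ ⨆ n, dimH (c n) := (dimH_mono hc).trans (dimH_iUnion c).le
  have h2 := hlt.trans_le (EReal.coe_ennreal_le_coe_ennreal_iff.2 h1)
  have h3 : (((⨆ n, dimH (c n) : ℝ≥0∞)) : EReal) ≤ ⨆ n, upperBoxDim (c n) := by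
    have h0 : (0 : EReal) ≤ ⨆ n, upperBoxDim (c n) := (ubd_nonneg (c 0)).trans (le_iSup (fun n => upperBoxDim (c n)) 0)
    rw [← EReal.coe_toENNReal h0, EReal.coe_ennreal_le_coe_ennreal_iff]
    refine iSup_le fun n => ?_
    rw [← EReal.coe_ennreal_le_coe_ennreal_iff, EReal.coe_toENNReal h0]
    exact (dimH_le_ubd _).trans (le_iSup (fun n => upperBoxDim (c n)) n)
  exact absurd h2 (not_lt.2 h3)

lemma packingDim_le_ubd {X : Type*} [PseudoMetricSpace X] (s : Set X) :
    packingDim s ≤ upperBoxDim s := by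
  unfold packingDim
  exact (iInf₂_le (fun _ => s) (subset_iUnion (fun _ : ℕ => s) 0)).trans (iSup_le fun _ => le_rfl)

lemma cov_cantor_le (N : ℕ) (hN : 2 ≤ N) {m : ℕ}
    (A : Finset (Fin m → ℕ)) (hAN : ∀ v ∈ A, ∀ j, v j < N) (n : ℕ) (hn : 1 ≤ n) (k : ℕ)
    (hk : n < N ^ k) :
    coveringNumber (1 / n) (cantorDigitSetPi N (↑A : Set (Fin m → ℕ))) ≤ ((A.card ^ k : ℕ) : ℝ≥0∞) := by
  classical
  let F : (Fin k → A) → (Fin m → ℝ) := fun w j =>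
    (cdPre N (fun i => if h : i < k then (w ⟨i, h⟩ : Fin m → ℕ) j else 0) k : ℝ) / N ^ k
  let t : Finset (Fin m → ℝ) := Finset.univ.image F
  have hmem : ∀ w, F w ∈ t := fun w => Finset.mem_image_of_mem F (Finset.mem_univ w)
  have hcard : t.card ≤ A.card ^ k := by
    refine Finset.card_image_le.trans ?_
    simp
  have hcov : cantorDigitSetPi N (↑A : Set (Fin m → ℕ)) ⊆ ⋃ x ∈ t, Metric.ball x (1 / n) := by
    rintro x ⟨a, ha, hx⟩
    simp only [mem_iUnion]
    have ha' : ∀ i, a i ∈ A := fun i => Finset.mem_coe.1 (ha i)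
    obtain ⟨w, hw⟩ : ∃ w : Fin k → A, ∀ i, (w i : Fin m → ℕ) = a i := ⟨fun i => ⟨a i, ha' i⟩, fun _ => rfl⟩
    refine ⟨F w, hmem w, ?_⟩
    have hn0 : (0 : ℝ) < n := by positivity
    rw [Metric.mem_ball, dist_pi_lt_iff (by positivity)]
    intro j
    have hb := cdVal_bounds (N := N) (a := fun i => a i j) (fun i => hAN _ (ha' i) j) k
    have hxj : x j = cdVal N (fun i => a i j) := hx j
    have hF : F w j = (cdPre N (fun i => a i j) k : ℝ) / N ^ k := by
      simp only [F]
      congr 2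
      apply cdPre_congr
      intro i hi
      simp [hi, hw]
    have hNk : (0 : ℝ) < (N : ℝ) ^ k := by positivity
    have hnk : (n : ℝ) < (N : ℝ) ^ k := by exact_mod_cast hk
    rw [hF, hxj, Real.dist_eq]
    refine lt_of_le_of_lt ?_ (one_div_lt_one_div_of_lt hn0 hnk)
    rw [abs_le]
    constructor
    · have : (0:ℝ) ≤ 1 / N ^ k := by positivity
      have : (cdPre N (fun i => a i j) k : ℝ) / N ^ k ≤ cdVal N (fun i => a i j) := by
        rw [div_le_iff₀ hNk]; linarith [hb.1]
      linarith
    · rw [sub_le_iff_le_add, ← add_div, le_div_iff₀ hNk]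
      linarith [hb.2]
  unfold coveringNumber
  refine (iInf₂_le t hcov).trans ?_
  exact_mod_cast hcard

lemma ubd_cantor_le (N : ℕ) (hN : 2 ≤ N) {m : ℕ}
    (A : Finset (Fin m → ℕ)) (hA : A.Nonempty) (hAN : ∀ v ∈ A, ∀ j, v j < N) :
    upperBoxDim (cantorDigitSetPi N (↑A : Set (Fin m → ℕ))) ≤
      ((Real.log A.card / Real.log N : ℝ) : EReal) := by
  have hlN : 0 < Real.log N := Real.log_pos (by exact_mod_cast hN)
  have hA1 : 1 ≤ A.card := hA.card_pos
  have hlA : 0 ≤ Real.log A.card := Real.log_natCast_nonneg _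
  have hlim : Tendsto (fun n : ℕ => ((Real.log A.card / Real.log N + Real.log A.card / Real.log n : ℝ) : EReal))
      atTop (𝓝 ((Real.log A.card / Real.log N : ℝ) : EReal)) := by
    apply (continuous_coe_real_ereal.tendsto _).comp
    have : Tendsto (fun n : ℕ => Real.log A.card / Real.log n) atTop (𝓝 0) :=
      tendsto_const_nhds.div_atTop (Real.tendsto_log_atTop.comp tendsto_natCast_atTop_atTop)
    simpa using this.const_add (Real.log A.card / Real.log N)
  rw [← hlim.limsup_eq]
  unfold upperBoxDim
  refine limsup_le_limsup ?_ (by isBoundedDefault) (by isBoundedDefault)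
  filter_upwards [eventually_ge_atTop 2] with n hn
  have hln : 0 < Real.log n := Real.log_pos (by exact_mod_cast hn)
  set k := Nat.log N n + 1 with hkdef
  have hk : n < N ^ k := Nat.lt_pow_succ_log_self hN n
  have hc := cov_cantor_le N hN A hAN n (by omega) k hk
  set c := coveringNumber (1 / n) (cantorDigitSetPi N (↑A : Set (Fin m → ℕ))) with hcdef
  have hfin : c ≠ ⊤ := ne_top_of_le_ne_top (by simp) hc
  rw [elog, if_neg hfin]
  norm_cast
  have h1 : Real.log c.toReal ≤ k * Real.log A.card := by
    rw [← Real.log_pow]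
    have hc' : c.toReal ≤ (A.card : ℝ) ^ k := by
      have := ENNReal.toReal_mono (by simp) hc
      simpa using this
    rcases (ENNReal.toReal_nonneg (a := c)).eq_or_lt with h0 | h0
    · rw [← h0, Real.log_zero, Real.log_pow]; positivity
    · exact Real.log_le_log h0 hc'
  have h2 : (Nat.log N n : ℝ) * Real.log N ≤ Real.log n := by
    rw [← Real.log_pow]
    apply Real.log_le_log (by positivity)
    exact_mod_cast Nat.pow_log_le_self N (by omega)
  have h3 : (k : ℝ) ≤ Real.log n / Real.log N + 1 := by
    rw [hkdef]; push_cast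
    have := (le_div_iff₀ hlN).2 h2
    linarith
  calc Real.log c.toReal * (Real.log n)⁻¹ ≤ ((Real.log n / Real.log N + 1) * Real.log A.card) * (Real.log n)⁻¹ := by
        gcongr
        exact h1.trans (by gcongr)
    _ = _ := by field_simp

section lower
variable (N : ℕ) {m : ℕ} (A : Finset (Fin m → ℕ)) [NeZero A.card]

/-- digit word in `A` of the real number `t` -/
noncomputable def cdWord (t : ℝ) (i : ℕ) : Fin m → ℕ :=
  ((A.equivFin.symm (Real.digits t A.card i) : A) : Fin m → ℕ)

noncomputable def cdPt (t : ℝ) : Fin m → ℝ := fun j => cdVal N (fun i => cdWord A t i j)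

lemma cdPt_mem (t : ℝ) : cdPt N A t ∈ cantorDigitSetPi N (↑A : Set (Fin m → ℕ)) :=
  ⟨cdWord A t, fun i => (A.equivFin.symm (Real.digits t A.card i)).2, fun _ => rfl⟩

lemma vol_le (hN : 2 ≤ N) (hA : 2 ≤ A.card) (hAN : ∀ v ∈ A, ∀ j, v j < N)
    (U : Set (Fin m → ℝ)) (k : ℕ) (hU : Metric.ediam U ≤ ENNReal.ofReal ((N : ℝ) ^ k)⁻¹) :
    volume {t | t ∈ Ico (0:ℝ) 1 ∧ cdPt N A t ∈ U} ≤ 5 ^ m * ENNReal.ofReal ((A.card : ℝ) ^ k)⁻¹ := by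
  classical
  set S := {t | t ∈ Ico (0:ℝ) 1 ∧ cdPt N A t ∈ U} with hS
  rcases S.eq_empty_or_nonempty with he | ⟨t0, ht0⟩
  · rw [he]; simp
  have hlt : ∀ t i j, cdWord A t i j < N := fun t i j => hAN _ (A.equivFin.symm (Real.digits t A.card i)).2 j
  let Q : ℝ → Fin m → ℕ := fun t j => cdPre N (fun i => cdWord A t i j) k
  let P : Finset (Fin m → ℕ) := Fintype.piFinset fun j => Finset.Icc (Q t0 j - 2) (Q t0 j + 2)
  have hP : P.card ≤ 5 ^ m := by
    rw [Fintype.card_piFinset]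
    refine (Finset.prod_le_pow_card _ _ 5 ?_).trans (by simp)
    intro j _
    simp only [Nat.card_Icc]
    omega
  have hNk : (0 : ℝ) < (N : ℝ) ^ k := by positivity
  have hsub : S ⊆ ⋃ q ∈ P, {t | t ∈ S ∧ Q t = q} := by
    intro t ht
    simp only [mem_iUnion]
    refine ⟨Q t, ?_, ht, rfl⟩
    rw [Fintype.mem_piFinset]
    intro j
    have hd : dist (cdPt N A t j) (cdPt N A t0 j) ≤ ((N : ℝ) ^ k)⁻¹ := by
      have h1 : edist (cdPt N A t) (cdPt N A t0) ≤ ENNReal.ofReal ((N : ℝ) ^ k)⁻¹ :=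
        (Metric.edist_le_ediam_of_mem ht.2 ht0.2).trans hU
      rw [edist_dist, ENNReal.ofReal_le_ofReal_iff (by positivity)] at h1
      exact (dist_le_pi_dist _ _ j).trans h1
    rw [Real.dist_eq, abs_le] at hd
    have b1 := cdVal_bounds (fun i => hlt t i j) k
    have b0 := cdVal_bounds (fun i => hlt t0 i j) k
    have e1 : (N : ℝ) ^ k * (cdPt N A t j - cdPt N A t0 j) ≤ 1 := by
      have := mul_le_mul_of_nonneg_left hd.2 hNk.le
      rwa [mul_inv_cancel₀ hNk.ne'] at this
    have e2 : -1 ≤ (N : ℝ) ^ k * (cdPt N A t j - cdPt N A t0 j) := by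
      have := mul_le_mul_of_nonneg_left hd.1 hNk.le
      rwa [mul_neg, mul_inv_cancel₀ hNk.ne'] at this
    simp only [cdPt] at e1 e2
    have f1 : (Q t j : ℝ) ≤ Q t0 j + 2 := by simp only [Q]; linarith [b1.1, b0.2]
    have f2 : (Q t0 j : ℝ) ≤ Q t j + 2 := by simp only [Q]; linarith [b1.2, b0.1]
    have f1' : Q t j ≤ Q t0 j + 2 := by exact_mod_cast f1
    have f2' : Q t0 j ≤ Q t j + 2 := by exact_mod_cast f2
    rw [Finset.mem_Icc]
    omega
  have hpiece : ∀ q, volume {t | t ∈ S ∧ Q t = q} ≤ ENNReal.ofReal ((A.card : ℝ) ^ k)⁻¹ := by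
    intro q
    refine (Real.volume_le_diam _).trans (Metric.ediam_le ?_)
    rintro t ⟨ht, htq⟩ t' ⟨ht', htq'⟩
    have hdig : ∀ i < k, Real.digits t A.card i = Real.digits t' A.card i := by
      intro i hi
      have : cdWord A t i = cdWord A t' i := by
        funext j
        have hq : Q t j = Q t' j := by rw [htq, htq']
        exact cdPre_inj (fun i => hlt t i j) (fun i => hlt t' i j) k hq i hi
      exact A.equivFin.symm.injective (Subtype.ext this)
    have := Real.abs_ofDigits_sub_ofDigits_le hdig
    rw [Real.ofDigits_digits hA ht.1, Real.ofDigits_digits hA ht'.1] at this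
    rw [edist_dist, Real.dist_eq]
    exact ENNReal.ofReal_le_ofReal this
  calc volume S ≤ volume (⋃ q ∈ P, {t | t ∈ S ∧ Q t = q}) := measure_mono hsub
    _ ≤ ∑ q ∈ P, volume {t | t ∈ S ∧ Q t = q} := measure_biUnion_finset_le _ _
    _ ≤ ∑ q ∈ P, ENNReal.ofReal ((A.card : ℝ) ^ k)⁻¹ := Finset.sum_le_sum fun q _ => hpiece q
    _ = P.card * ENNReal.ofReal ((A.card : ℝ) ^ k)⁻¹ := by simp
    _ ≤ _ := by
      gcongr
      exact_mod_cast hP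

lemma vol_le_rpow (hN : 2 ≤ N) (hA : 2 ≤ A.card) (hAN : ∀ v ∈ A, ∀ j, v j < N)
    (U : Set (Fin m → ℝ)) (hU : Metric.ediam U ≤ 1) :
    volume {t | t ∈ Ico (0:ℝ) 1 ∧ cdPt N A t ∈ U} ≤
      (5 ^ m * A.card) * Metric.ediam U ^ (Real.log A.card / Real.log N) := by
  have hN0 : (0:ℝ) < N := by positivity
  have hN1 : (1:ℝ) < N := by exact_mod_cast hN
  have hA1 : (1:ℝ) < A.card := by exact_mod_cast hA
  have hA0 : (0:ℝ) < A.card := by linarith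
  have hlN : 0 < Real.log N := Real.log_pos hN1
  have hlA : 0 < Real.log A.card := Real.log_pos hA1
  set s := Real.log A.card / Real.log N with hs
  have hs0 : 0 < s := by positivity
  have hNs : (N : ℝ) ^ s = A.card := by
    rw [Real.rpow_def_of_pos hN0, hs, mul_div_cancel₀ _ hlN.ne', Real.exp_log hA0]
  have hfin : Metric.ediam U ≠ ⊤ := ne_top_of_le_ne_top ENNReal.one_ne_top hU
  rcases eq_or_ne (Metric.ediam U) 0 with h0 | h0
  · have h1 : Tendsto (fun k : ℕ => (5 : ℝ≥0∞) ^ m * ENNReal.ofReal ((A.card : ℝ) ^ k)⁻¹) atTop (𝓝 (5 ^ m * ENNReal.ofReal 0)) := by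
      refine ENNReal.Tendsto.const_mul (ENNReal.tendsto_ofReal ?_) (Or.inr (ENNReal.pow_ne_top (by norm_num)))
      exact tendsto_inv_atTop_zero.comp (tendsto_pow_atTop_atTop_of_one_lt hA1)
    have h2 := ge_of_tendsto' h1 (fun k => vol_le N A hN hA hAN U k (by rw [h0]; exact bot_le))
    simp only [ENNReal.ofReal_zero, mul_zero] at h2
    exact h2.trans bot_le
  · set r := (Metric.ediam U).toReal with hr
    have hr0 : 0 < r := ENNReal.toReal_pos h0 hfin
    have hr1 : r ≤ 1 := by simpa using ENNReal.toReal_mono ENNReal.one_ne_top hU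
    have hre : Metric.ediam U = ENNReal.ofReal r := (ENNReal.ofReal_toReal hfin).symm
    obtain ⟨k, hk1, hk2⟩ := exists_nat_pow_near_of_lt_one hr0 hr1 (inv_pos.2 hN0) (inv_lt_one_of_one_lt₀ hN1)
    rw [inv_pow] at hk1 hk2
    refine (vol_le N A hN hA hAN U k (by rw [hre]; exact ENNReal.ofReal_le_ofReal hk2)).trans ?_
    rw [mul_assoc]
    gcongr
    rw [hre, ENNReal.ofReal_rpow_of_pos hr0, ← ENNReal.ofReal_natCast, ← ENNReal.ofReal_mul hA0.le]
    apply ENNReal.ofReal_le_ofReal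
    have h3 : (((N : ℝ) ^ (k + 1))⁻¹) ^ s ≤ r ^ s := Real.rpow_le_rpow (by positivity) hk1.le hs0.le
    rw [Real.inv_rpow (by positivity), ← Real.rpow_natCast, ← Real.rpow_mul hN0.le, mul_comm,
      Real.rpow_mul hN0.le, hNs, Real.rpow_natCast] at h3
    have h4 := mul_le_mul_of_nonneg_left h3 hA0.le
    refine le_trans (le_of_eq ?_) h4
    rw [pow_succ', mul_inv, mul_inv_cancel_left₀ hA0.ne']

lemma le_dimH_aux (hN : 2 ≤ N) (hA : 2 ≤ A.card) (hAN : ∀ v ∈ A, ∀ j, v j < N) :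
    ENNReal.ofReal (Real.log A.card / Real.log N) ≤
      dimH (cantorDigitSetPi N (↑A : Set (Fin m → ℕ))) := by
  have hs0 : 0 ≤ Real.log A.card / Real.log N :=
    div_nonneg (Real.log_natCast_nonneg _) (Real.log_natCast_nonneg _)
  set s := Real.log A.card / Real.log N with hs
  set c : ℝ≥0∞ := 5 ^ m * A.card with hc
  have hc0 : c ≠ 0 := by
    have : A.card ≠ 0 := by omega
    exact mul_ne_zero (pow_ne_zero _ (by norm_num)) (by exact_mod_cast this)
  have hct : c ≠ ⊤ := by
    rw [hc]
    exact ENNReal.mul_ne_top (ENNReal.pow_ne_top (by norm_num)) (ENNReal.natCast_ne_top _)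
  have key : c⁻¹ ≤ μH[s] (cantorDigitSetPi N (↑A : Set (Fin m → ℕ))) := by
    rw [Measure.hausdorffMeasure_apply]
    refine le_trans ?_ (le_iSup₂ (1 : ℝ≥0∞) zero_lt_one)
    refine le_iInf fun t => le_iInf fun ht => le_iInf fun hd => ?_
    rw [ENNReal.inv_le_iff_le_mul (fun _ => hc0) (fun h => absurd h hct), ← ENNReal.tsum_mul_left]
    have h1 : (1 : ℝ≥0∞) = volume (Ico (0:ℝ) 1) := by simp
    rw [h1]
    have hsub : Ico (0:ℝ) 1 ⊆ ⋃ n, {x | x ∈ Ico (0:ℝ) 1 ∧ cdPt N A x ∈ t n} := by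
      intro x hx
      obtain ⟨n, hn⟩ := mem_iUnion.1 (ht (cdPt_mem N A x))
      exact mem_iUnion.2 ⟨n, hx, hn⟩
    refine (measure_mono hsub).trans ((measure_iUnion_le _).trans (ENNReal.tsum_le_tsum fun n => ?_))
    rcases (t n).eq_empty_or_nonempty with he | hne
    · rw [he]; simp
    · rw [ciSup_pos hne]
      exact vol_le_rpow N A hN hA hAN (t n) (hd n)
  have := le_dimH_of_hausdorffMeasure_ne_zero (d := ⟨s, hs0⟩)
    (s := cantorDigitSetPi N (↑A : Set (Fin m → ℕ)))
    (fun h => by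
      have h' : μH[s] (cantorDigitSetPi N (↑A : Set (Fin m → ℕ))) = 0 := h
      rw [h'] at key
      exact hct (ENNReal.inv_eq_zero.1 (le_antisymm key bot_le)))
  refine le_trans (le_of_eq ?_) this
  rw [ENNReal.ofReal_eq_coe_nnreal hs0]
  rfl

end lower

/-- Both the Hausdorff and packing dimensions of `C_A` equal `log|A| / log N`. -/
theorem dims_cantorDigitSetPi (N : ℕ) (hN : 2 ≤ N) {m : ℕ} (hm : 1 ≤ m)
    (A : Finset (Fin m → ℕ)) (hA : A.Nonempty) (hAN : ∀ v ∈ A, ∀ j, v j < N) :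
    dimH (cantorDigitSetPi N (↑A : Set (Fin m → ℕ))) =
      ENNReal.ofReal (Real.log A.card / Real.log N) ∧
    packingDim (cantorDigitSetPi N (↑A : Set (Fin m → ℕ))) =
      ((Real.log A.card / Real.log N : ℝ) : EReal) := by
  have hs0 : 0 ≤ Real.log A.card / Real.log N :=
    div_nonneg (Real.log_natCast_nonneg _) (Real.log_natCast_nonneg _)
  have h1 : ENNReal.ofReal (Real.log A.card / Real.log N) ≤
      dimH (cantorDigitSetPi N (↑A : Set (Fin m → ℕ))) := by
    have : 0 < A.card := hA.card_pos
    have : NeZero A.card := ⟨this.ne'⟩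
    rcases Nat.lt_or_ge A.card 2 with h | h
    · have : A.card = 1 := by omega
      simp [this]
    · exact le_dimH_aux N A hN h hAN
  have h2 := dimH_le_packingDim (cantorDigitSetPi N (↑A : Set (Fin m → ℕ)))
  have h3 := (packingDim_le_ubd _).trans (ubd_cantor_le N hN A hA hAN)
  have he : ((ENNReal.ofReal (Real.log A.card / Real.log N) : ℝ≥0∞) : EReal) =
      ((Real.log A.card / Real.log N : ℝ) : EReal) := by
    rw [EReal.coe_ennreal_ofReal, max_eq_left hs0]
  have h1' := EReal.coe_ennreal_le_coe_ennreal_iff.2 h1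
  rw [he] at h1'
  refine ⟨le_antisymm ?_ h1, le_antisymm h3 (h1'.trans h2)⟩
  rw [← EReal.coe_ennreal_le_coe_ennreal_iff, he]
  exact h2.trans h3
end
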